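/- arXiv:2312.15333 — 3 statements merged into one kernel-verified Lean document; each statement's English description precedes it below -/
import Mathlib

section
/- Let ε ∈ (0, 1/2) and a ≥ 1, and let G be a graph. Assume that for every induced subgraph F of G with |F| ≥ ε^{2a}·|G|, there exists a real k with 2 ≤ k ≤ 1/ε such that there is a complete or anticomplete (k, |F|/k^a)-blockade in F. Then G has an ε-restricted induced subgraph with at least ε^{3a}·|G| vertices. -/
open Finset
open scoped Classical

/-- A copy of `H` in `G`: an injective map preserving adjacency and non-adjacency. -/
def IsCopy {W V : Type*} (H : SimpleGraph W) (G : SimpleGraph V) (f : W → V) : Prop :=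
  Function.Injective f ∧ ∀ u v : W, H.Adj u v ↔ G.Adj (f u) (f v)

/-- `G` is `H`-free: there is no copy of `H` in `G`. -/
def Free {W V : Type*} (H : SimpleGraph W) (G : SimpleGraph V) : Prop :=
  ¬ ∃ f : W → V, IsCopy H G f

/-- The path on five vertices. -/
def P5 : SimpleGraph (Fin 5) := SimpleGraph.pathGraph 5

/-- The neighbours of `v` inside the finite set `A`. -/
noncomputable def nbrsIn {V : Type*} (G : SimpleGraph V) (v : V) (A : Finset V) : Finset V :=
  A.filter (fun u => G.Adj v u)

/-- `G` is `x`-sparse: every vertex has degree at most `x * |G|`. -/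
def Sparse {V : Type*} [Fintype V] (G : SimpleGraph V) (x : ℝ) : Prop :=
  ∀ v : V, ((nbrsIn G v Finset.univ).card : ℝ) ≤ x * (Fintype.card V : ℝ)

/-- `G` is `x`-restricted: `G` or its complement is `x`-sparse. -/
def Restricted {V : Type*} [Fintype V] (G : SimpleGraph V) (x : ℝ) : Prop :=
  Sparse G x ∨ Sparse Gᶜ x

/-- The induced subgraph `G[S]` is `x`-sparse. -/
def SparseOn {V : Type*} (G : SimpleGraph V) (S : Finset V) (x : ℝ) : Prop :=
  ∀ v ∈ S, ((nbrsIn G v S).card : ℝ) ≤ x * (S.card : ℝ)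

/-- The induced subgraph `G[S]` is `x`-restricted: it or its complement is `x`-sparse. -/
def RestrictedOn {V : Type*} (G : SimpleGraph V) (S : Finset V) (x : ℝ) : Prop :=
  SparseOn G S x ∨ SparseOn Gᶜ S x

/-- `(A, B)` is complete in `G`. -/
def CompletePair {V : Type*} (G : SimpleGraph V) (A B : Finset V) : Prop :=
  ∀ a ∈ A, ∀ b ∈ B, G.Adj a b

/-- `(A, B)` is anticomplete in `G`. -/
def AnticompletePair {V : Type*} (G : SimpleGraph V) (A B : Finset V) : Prop :=
  ∀ a ∈ A, ∀ b ∈ B, ¬ G.Adj a b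

/-- `B` is `x`-sparse to `A` in `G`: every vertex of `B` has at most `x * |A|` neighbours in `A`. -/
def SparseTo {V : Type*} (G : SimpleGraph V) (x : ℝ) (A B : Finset V) : Prop :=
  ∀ v ∈ B, ((nbrsIn G v A).card : ℝ) ≤ x * (A.card : ℝ)

/-- The number of edges of `G` between `A` and `B`. -/
noncomputable def edgesBetween {V : Type*} (G : SimpleGraph V) (A B : Finset V) : ℕ :=
  ((A ×ˢ B).filter (fun p => G.Adj p.1 p.2)).card

/-- `(A, B)` is weakly `x`-sparse in `G`. -/
def WeaklySparse {V : Type*} (G : SimpleGraph V) (x : ℝ) (A B : Finset V) : Prop :=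
  (edgesBetween G A B : ℝ) ≤ x * (A.card : ℝ) * (B.card : ℝ)

/-- A blockade: a sequence of pairwise disjoint vertex subsets. -/
def IsBlockade {V : Type*} {n : ℕ} (B : Fin n → Finset V) : Prop :=
  ∀ i j : Fin n, i ≠ j → Disjoint (B i) (B j)

/-- A pure blockade: every pair of distinct blocks is complete or anticomplete. -/
def PureBlockade {V : Type*} (G : SimpleGraph V) {n : ℕ} (B : Fin n → Finset V) : Prop :=
  ∀ i j : Fin n, i ≠ j → CompletePair G (B i) (B j) ∨ AnticompletePair G (B i) (B j)

/-- A complete blockade. -/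
def CompleteBlockade {V : Type*} (G : SimpleGraph V) {n : ℕ} (B : Fin n → Finset V) : Prop :=
  ∀ i j : Fin n, i ≠ j → CompletePair G (B i) (B j)

/-- An anticomplete blockade. -/
def AnticompleteBlockade {V : Type*} (G : SimpleGraph V) {n : ℕ} (B : Fin n → Finset V) : Prop :=
  ∀ i j : Fin n, i ≠ j → AnticompletePair G (B i) (B j)

/-- An `x`-sparse blockade: `B j` is `x`-sparse to `B i` whenever `i < j`. -/
def SparseBlockade {V : Type*} (G : SimpleGraph V) (x : ℝ) {n : ℕ} (B : Fin n → Finset V) : Prop :=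
  ∀ i j : Fin n, i < j → SparseTo G x (B i) (B j)

/-- A comb: a blockade `Bl` together with distinct apexes `a i`, outside all blocks, such that
`a i` is adjacent to all of `Bl i` and nonadjacent to all of `Bl j` for `j ≠ i`. -/
def IsComb {V : Type*} (G : SimpleGraph V) {k : ℕ} (a : Fin k → V) (Bl : Fin k → Finset V) :
    Prop :=
  IsBlockade Bl ∧ Function.Injective a ∧ (∀ i j : Fin k, a i ∉ Bl j) ∧
  (∀ i : Fin k, ∀ v ∈ Bl i, G.Adj (a i) v) ∧
  (∀ i j : Fin k, i ≠ j → ∀ v ∈ Bl j, ¬ G.Adj (a i) v)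

/-- There are `p` pairwise complete `q`-element subsets of `S`. -/
def HasCompleteFamily {V : Type*} (H : SimpleGraph V) (q : ℕ) (S : Finset V) (p : ℕ) : Prop :=
  ∃ F : Finset (Finset V), F.card = p ∧ (∀ A ∈ F, A ⊆ S ∧ A.card = q) ∧
    (F : Set (Finset V)).Pairwise (CompletePair H)

theorem CompletePair.disjoint {V : Type*} {H : SimpleGraph V} {A B : Finset V}
    (h : CompletePair H A B) : Disjoint A B :=
  Finset.disjoint_left.2 fun v hA hB => H.loopless.irrefl v (h v hA v hB)

theorem hasCompleteFamily_one {V : Type*} (H : SimpleGraph V) {q : ℕ} {S : Finset V}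
    (hq : q ≤ S.card) : HasCompleteFamily H q S 1 := by
  obtain ⟨A, hAS, hA⟩ := Finset.exists_subset_card_eq hq
  exact ⟨{A}, by simp, by simp [hAS, hA], by simp⟩

theorem HasCompleteFamily.mono {V : Type*} {H : SimpleGraph V} {q p : ℕ} {S T : Finset V}
    (h : HasCompleteFamily H q S p) (hST : S ⊆ T) : HasCompleteFamily H q T p := by
  obtain ⟨F, hp, hF, hc⟩ := h
  exact ⟨F, hp, fun A hA => ⟨(hF A hA).1.trans hST, (hF A hA).2⟩, hc⟩

theorem hasCompleteFamily_sum {V : Type*} {H : SimpleGraph V} {q n : ℕ} (hq : 0 < q)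
    {S : Finset V} {B : Fin n → Finset V} {r : Fin n → ℕ} (hBS : ∀ i, B i ⊆ S)
    (hB : CompleteBlockade H B) (h : ∀ i, HasCompleteFamily H q (B i) (r i)) :
    HasCompleteFamily H q S (∑ i, r i) := by
  choose F hp hF hc using h
  refine ⟨Finset.univ.biUnion F, ?_, ?_, ?_⟩
  · rw [Finset.card_biUnion]
    · exact Finset.sum_congr rfl fun i _ => hp i
    · intro i _ j _ hij
      refine Finset.disjoint_left.2 fun A hA hA' => ?_
      obtain ⟨v, hv⟩ : A.Nonempty := Finset.card_pos.1 ((hF i A hA).2 ▸ hq)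
      exact Finset.disjoint_left.1 (hB i j hij).disjoint ((hF i A hA).1 hv) ((hF j A hA').1 hv)
  · intro A hA
    obtain ⟨i, -, hi⟩ := Finset.mem_biUnion.1 hA
    exact ⟨(hF i A hi).1.trans (hBS i), (hF i A hi).2⟩
  · intro A hA A' hA' hne
    obtain ⟨i, -, hi⟩ := Finset.mem_biUnion.1 (Finset.mem_coe.1 hA)
    obtain ⟨j, -, hj⟩ := Finset.mem_biUnion.1 (Finset.mem_coe.1 hA')
    by_cases hij : i = j
    · subst hij
      exact hc i hi hj hne
    · exact fun v hv w hw => hB i j hij v ((hF i A hi).1 hv) w ((hF j A' hj).1 hw)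

/-- Families in the blocks of a complete blockade: those of `H` are merged, and a largest one
of those of `H'` is kept. -/
theorem exists_families_of_completeBlockade {V : Type*} {H H' : SimpleGraph V} {q n : ℕ}
    (hq : 0 < q) {S : Finset V} {B : Fin n → Finset V} (hBS : ∀ i, B i ⊆ S)
    (hB : CompleteBlockade H B) {x : ℝ} (hn : 0 < n)
    (h : ∀ i, ∃ r p : ℕ, HasCompleteFamily H q (B i) r ∧ HasCompleteFamily H' q (B i) p ∧
      x ≤ r * p) :
    ∃ r p : ℕ, HasCompleteFamily H q S r ∧ HasCompleteFamily H' q S p ∧ n * x ≤ r * p := by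
  choose r p hr hp hx using h
  have : Nonempty (Fin n) := ⟨⟨0, hn⟩⟩
  obtain ⟨i₀, hi₀⟩ := Finite.exists_max p
  refine ⟨∑ i, r i, p i₀, hasCompleteFamily_sum hq hBS hB hr, (hp i₀).mono (hBS i₀), ?_⟩
  calc (n : ℝ) * x = ∑ _i : Fin n, x := by simp
    _ ≤ ∑ i, (r i : ℝ) * p i₀ := Finset.sum_le_sum fun i _ => (hx i).trans <| by
        have : (p i : ℝ) ≤ p i₀ := by exact_mod_cast hi₀ i
        gcongr
    _ = ((∑ i, r i : ℕ) : ℝ) * p i₀ := by push_cast; rw [Finset.sum_mul]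

theorem mem_nbrsIn {V : Type*} {G : SimpleGraph V} {v w : V} {A : Finset V} :
    w ∈ nbrsIn G v A ↔ w ∈ A ∧ G.Adj v w :=
  Finset.mem_filter

/-- The union of a long family of pairwise complete equal-sized sets has a sparse complement. -/
theorem HasCompleteFamily.exists_sparseOn_compl {V : Type*} {H : SimpleGraph V} {q p : ℕ}
    {S : Finset V} (h : HasCompleteFamily H q S p) {x : ℝ} (hp : 0 < p) (hx : 1 ≤ x * p) :
    ∃ T : Finset V, q ≤ T.card ∧ SparseOn Hᶜ T x := by
  obtain ⟨F, hF, hS, hc⟩ := h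
  have hcard : (F.biUnion id).card = p * q := by
    rw [Finset.card_biUnion (t := id) fun A hA B hB hne => (hc hA hB hne).disjoint, ← hF]
    exact Finset.sum_const_nat fun A hA => (hS A hA).2
  refine ⟨F.biUnion id, hcard ▸ Nat.le_mul_of_pos_left q hp, fun v hv => ?_⟩
  obtain ⟨A, hA, hvA⟩ := Finset.mem_biUnion.1 hv
  have hsub : nbrsIn Hᶜ v (F.biUnion id) ⊆ A := by
    intro w hw
    obtain ⟨hw, hvw⟩ := mem_nbrsIn.1 hw
    obtain ⟨A', hA', hwA'⟩ := Finset.mem_biUnion.1 hw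
    by_cases hne : A = A'
    · exact hne ▸ hwA'
    · exact absurd (hc hA hA' hne v hvA w hwA') (SimpleGraph.compl_adj H v w |>.1 hvw).2
  have hle : ((nbrsIn Hᶜ v (F.biUnion id)).card : ℝ) ≤ q := by
    exact_mod_cast (Finset.card_le_card hsub).trans (hS A hA).2.le
  rw [hcard]
  push_cast
  nlinarith [(Nat.cast_nonneg q : (0 : ℝ) ≤ q)]

theorem AnticompleteBlockade.completeBlockade_compl {V : Type*} {G : SimpleGraph V} {n : ℕ}
    {B : Fin n → Finset V} (h : AnticompleteBlockade G B) (hB : IsBlockade B) :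
    CompleteBlockade Gᶜ B := fun i j hij v hv w hw =>
  (SimpleGraph.compl_adj G v w).2
    ⟨fun hvw => Finset.disjoint_left.1 (hB i j hij) hv (hvw ▸ hw), h i j hij v hv w hw⟩

theorem IsBlockade.card_lt {V : Type*} {n : ℕ} {B : Fin n → Finset V} (hB : IsBlockade B)
    {S : Finset V} (hBS : ∀ i, B i ⊆ S) (hn : 2 ≤ n) (hne : ∀ i, (B i).Nonempty) (i : Fin n) :
    (B i).card < S.card := by
  have : Nontrivial (Fin n) := Fin.nontrivial_iff_two_le.2 hn
  obtain ⟨j, hj⟩ := exists_ne i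
  obtain ⟨v, hv⟩ := hne j
  exact Finset.card_lt_card ⟨hBS i, fun h => Finset.disjoint_left.1 (hB j i hj) hv
    (h (hBS j hv))⟩

/-- Iterating the complete or anticomplete blockades of large sets yields families in `G` and in
its complement whose lengths have a large product. -/
theorem exists_complete_families {V : Type*} (G : SimpleGraph V) {a c K : ℝ} {q : ℕ}
    (ha : 0 < a) (hc : 0 < c) (hq : 0 < q) (hqc : ∀ m : ℕ, c / K ^ a ≤ m → q ≤ m)
    (hyp : ∀ S : Finset V, c ≤ (S.card : ℝ) →
      ∃ k : ℝ, 2 ≤ k ∧ k ≤ K ∧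
        ∃ (n : ℕ) (B : Fin n → Finset V), (∀ i, B i ⊆ S) ∧ IsBlockade B ∧ k ≤ (n : ℝ) ∧
          (∀ i, (S.card : ℝ) / k ^ a ≤ ((B i).card : ℝ)) ∧
          (CompleteBlockade G B ∨ AnticompleteBlockade G B))
    (S : Finset V) (hS : c / K ^ a ≤ S.card) :
    ∃ r p : ℕ, HasCompleteFamily G q S r ∧ HasCompleteFamily Gᶜ q S p ∧
      ((S.card : ℝ) / c) ^ a⁻¹ ≤ r * p := by
  induction hs : S.card using Nat.strong_induction_on generalizing S with
  | _ s ih =>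
  subst hs
  rcases lt_or_ge (S.card : ℝ) c with hlt | hge
  · refine ⟨1, 1, hasCompleteFamily_one G (hqc _ hS), hasCompleteFamily_one Gᶜ (hqc _ hS), ?_⟩
    have : (S.card : ℝ) / c ≤ 1 := (div_le_one hc).2 hlt.le
    simpa using Real.rpow_le_one (by positivity) this (by positivity)
  · obtain ⟨k, hk2, hkK, n, B, hBS, hB, hkn, hcard, hcomp⟩ := hyp S hge
    have hk : 0 < k := by linarith
    have hka : 0 < k ^ a := Real.rpow_pos_of_pos hk a
    have hn : 2 ≤ n := by exact_mod_cast hk2.trans hkn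
    have hne : ∀ i, (B i).Nonempty := fun i => by
      have h : (0 : ℝ) < (B i).card := (div_pos (hc.trans_le hge) hka).trans_le (hcard i)
      exact Finset.card_pos.1 (by exact_mod_cast h)
    have hstep : ∀ i, ((S.card : ℝ) / c) ^ a⁻¹ / k ≤ (((B i).card : ℝ) / c) ^ a⁻¹ := fun i => by
      calc ((S.card : ℝ) / c) ^ a⁻¹ / k = ((S.card : ℝ) / c / k ^ a) ^ a⁻¹ := by
            rw [Real.div_rpow (by positivity) hka.le, Real.rpow_rpow_inv hk.le ha.ne']
        _ ≤ (((B i).card : ℝ) / c) ^ a⁻¹ := by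
            rw [div_right_comm]
            have := hcard i
            gcongr
    have hrec : ∀ i, ∃ r p : ℕ, HasCompleteFamily G q (B i) r ∧ HasCompleteFamily Gᶜ q (B i) p ∧
        ((S.card : ℝ) / c) ^ a⁻¹ / k ≤ r * p := fun i => by
      have hBi : c / K ^ a ≤ (B i).card := by
        refine le_trans ?_ (hcard i)
        gcongr
      obtain ⟨r, p, hr, hp, h⟩ := ih _ (hB.card_lt hBS hn hne i) (B i) hBi rfl
      exact ⟨r, p, hr, hp, (hstep i).trans h⟩
    have hfin : ((S.card : ℝ) / c) ^ a⁻¹ ≤ n * (((S.card : ℝ) / c) ^ a⁻¹ / k) := by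
      rw [mul_div_left_comm]
      exact le_mul_of_one_le_right (by positivity) ((one_le_div hk).2 hkn)
    rcases hcomp with hG | hG
    · obtain ⟨r, p, hr, hp, h⟩ := exists_families_of_completeBlockade hq hBS hG (by omega) hrec
      exact ⟨r, p, hr, hp, hfin.trans h⟩
    · obtain ⟨p, r, hp, hr, h⟩ := exists_families_of_completeBlockade (H' := G) hq hBS
        (hG.completeBlockade_compl hB) (by omega) fun i => by
          obtain ⟨r, p, hr, hp, h⟩ := hrec i
          exact ⟨p, r, hp, hr, by rwa [mul_comm]⟩
      exact ⟨r, p, hr, hp, hfin.trans (by rwa [mul_comm (r : ℝ)])⟩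

/-- from complete-or-anticomplete blockades in all large induced subgraphs to a
large restricted induced subgraph. -/
theorem blocks_to_restricted
    (V : Type) [Fintype V] (G : SimpleGraph V) (ε a : ℝ)
    (hε : 0 < ε) (hε2 : ε < 1/2) (ha : 1 ≤ a)
    (hyp : ∀ S : Finset V, ε ^ (2 * a) * (Fintype.card V : ℝ) ≤ (S.card : ℝ) →
      ∃ k : ℝ, 2 ≤ k ∧ k ≤ 1 / ε ∧
        ∃ (n : ℕ) (B : Fin n → Finset V), (∀ i, B i ⊆ S) ∧ IsBlockade B ∧ k ≤ (n : ℝ) ∧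
          (∀ i, (S.card : ℝ) / k ^ a ≤ ((B i).card : ℝ)) ∧
          (CompleteBlockade G B ∨ AnticompleteBlockade G B)) :
    ∃ S : Finset V, ε ^ (3 * a) * (Fintype.card V : ℝ) ≤ (S.card : ℝ) ∧
      RestrictedOn G S ε := by
  rcases isEmpty_or_nonempty V with hV | hV
  · exact ⟨∅, by simp, Or.inl fun v => isEmptyElim v⟩
  have hN : (0 : ℝ) < Fintype.card V := by exact_mod_cast Fintype.card_pos
  have ha0 : 0 < a := by linarith
  have hpow : ∀ b : ℝ, 0 < ε ^ b := Real.rpow_pos_of_pos hε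
  have hlow : ε ^ (2 * a) * (Fintype.card V : ℝ) / (1 / ε) ^ a =
      ε ^ (3 * a) * Fintype.card V := by
    rw [one_div, Real.inv_rpow hε.le, div_inv_eq_mul, mul_right_comm, ← Real.rpow_add hε]
    ring_nf
  obtain ⟨r, p, hr, hp, h⟩ := exists_complete_families G (q := ⌈ε ^ (3 * a) * Fintype.card V⌉₊)
    ha0 (mul_pos (hpow _) hN) (Nat.ceil_pos.2 (mul_pos (hpow _) hN))
    (fun m hm => Nat.ceil_le.2 (hlow ▸ hm)) hyp Finset.univ (by
      rw [hlow, Finset.card_univ]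
      exact mul_le_of_le_one_left hN.le
        (Real.rpow_le_one hε.le (by linarith) (by linarith)))
  have hprod : 1 ≤ (ε * r) * (ε * p) := by
    have hx : ((Fintype.card V : ℝ) / (ε ^ (2 * a) * Fintype.card V)) ^ a⁻¹ = (ε ^ 2)⁻¹ := by
      rw [div_mul_cancel_right₀ hN.ne', Real.inv_rpow (hpow _).le, Real.rpow_mul hε.le,
        Real.rpow_rpow_inv (hpow _).le ha0.ne', Real.rpow_two]
    rw [Finset.card_univ, hx, inv_le_iff_one_le_mul₀ (by positivity)] at h
    linarith
  have hlong : 1 ≤ ε * r ∨ 1 ≤ ε * p := by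
    by_contra! hlt
    exact hprod.not_gt (mul_lt_one_of_nonneg_of_lt_one_left (by positivity) hlt.1 hlt.2.le)
  have hpos : ∀ m : ℕ, 1 ≤ ε * m → 0 < m := fun m hm => Nat.pos_of_ne_zero fun h0 => by
    norm_num [h0] at hm
  rcases hlong with hl | hl
  · obtain ⟨T, hT, hs⟩ := hr.exists_sparseOn_compl (hpos r hl) hl
    exact ⟨T, Nat.ceil_le.1 hT, Or.inr hs⟩
  · obtain ⟨T, hT, hs⟩ := hp.exists_sparseOn_compl (hpos p hl) hl
    exact ⟨T, Nat.ceil_le.1 hT, Or.inl (by rwa [compl_compl] at hs)⟩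
end

section
/- If a graph H has the polynomial Rödl property, then H has the Erdős–Hajnal property: that is, if there exists d > 0 such that for every ε ∈ (0, 1/2) every H-free graph G has an ε-restricted induced subgraph with at least ε^d·|G| vertices, then there exists τ > 0 such that every H-free graph on n ≥ 1 vertices has a clique or stable set of size at least n^τ. -/
open Finset
open scoped Classical

/-- If the maximum degree of `G[S]` is at most `D`, then `S` contains a stable set with at least
`|S| / (D + 1)` vertices. -/
theorem exists_stable_subset {V : Type*} (G : SimpleGraph V) (S : Finset V) (D : ℝ)
    (hD : ∀ v ∈ S, ((nbrsIn G v S).card : ℝ) ≤ D) :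
    ∃ T : Finset V, Gᶜ.IsClique (T : Set V) ∧ (S.card : ℝ) ≤ T.card * (D + 1) := by
  obtain ⟨T, hT, hmax⟩ :=
    (S.powerset.filter fun T : Finset V => Gᶜ.IsClique (T : Set V)).exists_max_image
      Finset.card ⟨∅, by simp⟩
  rw [mem_filter, mem_powerset] at hT
  refine ⟨T, hT.2, ?_⟩
  have hcover : S ⊆ T.biUnion fun v => insert v (nbrsIn G v S) := by
    intro u hu
    by_contra hnot
    simp only [mem_biUnion, mem_insert, nbrsIn, mem_filter, not_exists, not_and, not_or] at hnot
    have huT : u ∉ T := fun h => (hnot u h).1 rfl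
    have hclique : Gᶜ.IsClique ((insert u T : Finset V) : Set V) := by
      rw [coe_insert, SimpleGraph.isClique_insert]
      refine ⟨hT.2, fun v hv huv => ?_⟩
      rw [SimpleGraph.compl_adj]
      exact ⟨huv, fun hadj => (hnot v hv).2 hu hadj.symm⟩
    have hle := hmax (insert u T)
      (mem_filter.2 ⟨mem_powerset.2 (insert_subset hu hT.1), hclique⟩)
    rw [card_insert_of_notMem huT] at hle
    omega
  calc (S.card : ℝ) ≤ ((T.biUnion fun v => insert v (nbrsIn G v S)).card : ℝ) := by
        exact_mod_cast card_le_card hcover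
    _ ≤ ∑ v ∈ T, ((insert v (nbrsIn G v S)).card : ℝ) := by
        exact_mod_cast card_biUnion_le
    _ ≤ ∑ _v ∈ T, (D + 1) := by
        refine sum_le_sum fun v hv => ?_
        have hins : ((insert v (nbrsIn G v S)).card : ℝ) ≤ (nbrsIn G v S).card + 1 := by
          exact_mod_cast card_insert_le v (nbrsIn G v S)
        linarith [hD v (hT.1 hv)]
    _ = T.card * (D + 1) := by rw [sum_const, nsmul_eq_mul]

/-- A large `ε`-restricted induced subgraph contains a clique or stable set with at least
`1 / (2 * ε)` vertices. -/
theorem RestrictedOn.exists_clique_or_stable {V : Type*} {G : SimpleGraph V} {S : Finset V}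
    {ε : ℝ} (hε : 0 < ε) (hS : ε⁻¹ ≤ S.card) (h : RestrictedOn G S ε) :
    ∃ T : Finset V, (G.IsClique (T : Set V) ∨ Gᶜ.IsClique (T : Set V)) ∧
      ε⁻¹ / 2 ≤ T.card := by
  have hpos : (0 : ℝ) < S.card := (inv_pos.2 hε).trans_le hS
  have hone : 1 ≤ ε * S.card := by
    calc (1 : ℝ) = ε * ε⁻¹ := (mul_inv_cancel₀ hε.ne').symm
      _ ≤ ε * S.card := by gcongr
  have hsize : ∀ T : Finset V, (S.card : ℝ) ≤ T.card * (ε * S.card + 1) →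
      ε⁻¹ / 2 ≤ T.card := by
    intro T hT
    have hdouble : (1 : ℝ) * S.card ≤ (T.card * (2 * ε)) * S.card := by
      have : (T.card : ℝ) * (ε * S.card + 1) ≤ T.card * (2 * (ε * S.card)) := by
        gcongr
        linarith
      linarith
    have hle := le_of_mul_le_mul_right hdouble hpos
    rw [div_le_iff₀ two_pos, inv_le_iff_one_le_mul₀ hε]
    linarith
  rcases h with h | h
  · obtain ⟨T, hT, hcard⟩ := exists_stable_subset G S _ h
    exact ⟨T, Or.inr hT, hsize T hcard⟩
  · obtain ⟨T, hT, hcard⟩ := exists_stable_subset Gᶜ S _ h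
    rw [compl_compl] at hT
    exact ⟨T, Or.inl hT, hsize T hcard⟩

/-- A graph with at least two vertices has a clique or stable set of size two. -/
theorem exists_pair_clique_or_stable {V : Type*} [Fintype V] (G : SimpleGraph V)
    (hV : 1 < Fintype.card V) :
    ∃ T : Finset V, (G.IsClique (T : Set V) ∨ Gᶜ.IsClique (T : Set V)) ∧ T.card = 2 := by
  obtain ⟨a, b, hab⟩ := Fintype.one_lt_card_iff.1 hV
  refine ⟨{a, b}, ?_, card_pair hab⟩
  by_cases hadj : G.Adj a b
  · left
    simp [hadj]
  · right
    rw [coe_pair, SimpleGraph.isClique_pair]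
    exact fun _ => ⟨hab, hadj⟩

/-- the polynomial Rödl property implies the Erdős–Hajnal property. -/
theorem poly_rodl_implies_eh
    (W : Type) [Fintype W] (H : SimpleGraph W)
    (hrodl : ∃ d : ℝ, 0 < d ∧
      ∀ ε : ℝ, 0 < ε → ε < 1/2 →
        ∀ (V : Type) [Fintype V] (G : SimpleGraph V), Free H G →
          ∃ S : Finset V, ε ^ d * (Fintype.card V : ℝ) ≤ (S.card : ℝ) ∧
            RestrictedOn G S ε) :
    ∃ τ : ℝ, 0 < τ ∧
      ∀ (V : Type) [Fintype V] (G : SimpleGraph V), Free H G →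
        1 ≤ Fintype.card V →
        ∃ S : Finset V, (G.IsClique (S : Set V) ∨ Gᶜ.IsClique (S : Set V)) ∧
          (Fintype.card V : ℝ) ^ τ ≤ (S.card : ℝ) := by
  obtain ⟨d, hd, hrodl⟩ := hrodl
  have hd1 : 0 < d + 1 := by linarith
  refine ⟨(d + 1)⁻¹ / 2, by positivity, fun V _ G hfree hV => ?_⟩
  set n : ℝ := (Fintype.card V : ℝ) with hn
  set c : ℝ := (d + 1)⁻¹ with hc
  have hn1 : (1 : ℝ) ≤ n := by rw [hn]; exact_mod_cast hV
  have hn0 : 0 < n := by linarith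
  have hsq : n ^ c = n ^ (c / 2) * n ^ (c / 2) := by
    rw [← Real.rpow_add hn0, add_halves]
  rcases le_or_gt 2 (n ^ (c / 2)) with hlarge | hsmall
  · have hlarge' : 4 ≤ n ^ c := by rw [hsq]; nlinarith
    have hpos : 0 < n ^ c := by linarith
    have hlt : (n ^ c)⁻¹ < 1 / 2 := by
      rw [one_div]
      exact inv_strictAnti₀ two_pos (by linarith)
    obtain ⟨S, hS, hres⟩ := hrodl (n ^ c)⁻¹ (inv_pos.2 hpos) hlt V G hfree
    have hpow : ((n ^ c)⁻¹) ^ d * n = n ^ c := by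
      rw [← Real.rpow_neg hn0.le, ← Real.rpow_mul hn0.le]
      nth_rewrite 2 [← Real.rpow_one n]
      rw [← Real.rpow_add hn0]
      congr 1
      rw [hc]
      field_simp
      ring
    rw [← hn, hpow] at hS
    obtain ⟨T, hT, hcard⟩ :=
      hres.exists_clique_or_stable (inv_pos.2 hpos) (by rwa [inv_inv])
    refine ⟨T, hT, le_trans ?_ hcard⟩
    rw [inv_inv, hsq]
    nlinarith
  · rcases hV.eq_or_lt with hone | htwo
    · have hn_eq : n = 1 := by rw [hn, ← hone, Nat.cast_one]
      obtain ⟨v⟩ : Nonempty V := Fintype.card_pos_iff.1 hV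
      exact ⟨{v}, Or.inl (by simp), by simp [hn_eq]⟩
    · obtain ⟨T, hT, hcard⟩ := exists_pair_clique_or_stable G htwo
      exact ⟨T, hT, by rw [hcard]; exact_mod_cast hsmall.le⟩
end

section
/- For every ε ∈ (0, 1/2) and every graph H, there exists δ > 0 such that every H-free graph G has an ε-restricted induced subgraph with at least δ·|G| vertices (Rödl's theorem). -/
open Finset
open scoped Classical

lemma nbrsIn_mono {V : Type*} (G : SimpleGraph V) (v : V) {A B : Finset V} (h : A ⊆ B) :
    nbrsIn G v A ⊆ nbrsIn G v B :=
  Finset.filter_subset_filter _ h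

lemma edgesBetween_eq_sum_card {V : Type*} (G : SimpleGraph V) (A B : Finset V) :
    edgesBetween G A B = ∑ a ∈ A, (nbrsIn G a B).card := by
  simp only [edgesBetween, nbrsIn, Finset.card_filter, Finset.sum_product]

lemma edgesBetween_comm {V : Type*} (G : SimpleGraph V) (A B : Finset V) :
    edgesBetween G A B = edgesBetween G B A := by
  simp only [edgesBetween, Finset.card_filter, Finset.sum_product]
  rw [Finset.sum_comm]
  simp only [G.adj_comm]

lemma edgesBetween_union_left {V : Type*} (G : SimpleGraph V) {A A' : Finset V}
    (h : Disjoint A A') (B : Finset V) :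
    edgesBetween G (A ∪ A') B = edgesBetween G A B + edgesBetween G A' B := by
  simp only [edgesBetween_eq_sum_card, Finset.sum_union h]

lemma edgesBetween_union_self {V : Type*} (G : SimpleGraph V) {A B : Finset V}
    (h : Disjoint A B) :
    edgesBetween G (A ∪ B) (A ∪ B) =
      edgesBetween G A A + edgesBetween G B B + 2 * edgesBetween G A B := by
  rw [edgesBetween_union_left G h, edgesBetween_comm G A, edgesBetween_comm G B,
    edgesBetween_union_left G h, edgesBetween_union_left G h, edgesBetween_comm G B A]
  ring

lemma edgesBetween_le_mul {V : Type*} (G : SimpleGraph V) (A B : Finset V) :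
    edgesBetween G A B ≤ A.card * B.card :=
  (Finset.card_filter_le _ _).trans (Finset.card_product A B).le

/-- Sparsity bounds the number of edges. -/
lemma SparseTo.weaklySparse {V : Type*} {G : SimpleGraph V} {x : ℝ} {A B : Finset V}
    (h : SparseTo G x A B) : (edgesBetween G B A : ℝ) ≤ x * A.card * B.card := by
  rw [edgesBetween_eq_sum_card]
  push_cast
  calc ∑ b ∈ B, ((nbrsIn G b A).card : ℝ) ≤ ∑ _b ∈ B, x * (A.card : ℝ) := Finset.sum_le_sum h
    _ = x * A.card * B.card := by rw [Finset.sum_const, nsmul_eq_mul]; ring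

lemma SparseTo.mono {V : Type*} {G : SimpleGraph V} {x y : ℝ} {A B C : Finset V}
    (h : SparseTo G x A B) (hxy : x ≤ y) (hC : C ⊆ B) : SparseTo G y A C := fun v hv =>
  (h v (hC hv)).trans (by gcongr)

/-- If there are few edges between `A` and `B`, then half of `B` is sparse to `A`. -/
lemma exists_half_sparseTo {V : Type*} (G : SimpleGraph V) {x : ℝ} (hx : 0 < x)
    {A B : Finset V} (h : WeaklySparse G x A B) :
    ∃ C ⊆ B, (B.card : ℝ) ≤ 2 * C.card ∧ SparseTo G (2 * x) A C := by
  rcases A.eq_empty_or_nonempty with rfl | hA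
  · exact ⟨B, subset_rfl, by linarith [Nat.cast_nonneg (α := ℝ) B.card],
      fun v _ => by simp [nbrsIn]⟩
  let P : V → Prop := fun v => ((nbrsIn G v A).card : ℝ) ≤ 2 * x * A.card
  refine ⟨B.filter P, Finset.filter_subset _ _, ?_, fun v hv => (Finset.mem_filter.1 hv).2⟩
  have hcard : ((B.filter P).card : ℝ) + (B.filter (fun v => ¬ P v)).card = B.card := by
    exact_mod_cast Finset.card_filter_add_card_filter_not P
  have hbad : ((B.filter (fun v => ¬ P v)).card : ℝ) * (2 * x * A.card) ≤
      x * A.card * B.card := by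
    refine le_trans ?_ h
    rw [edgesBetween_comm, edgesBetween_eq_sum_card]
    push_cast
    calc ((B.filter (fun v => ¬ P v)).card : ℝ) * (2 * x * A.card)
        = ∑ _v ∈ B.filter (fun v => ¬ P v), 2 * x * (A.card : ℝ) := by
          rw [Finset.sum_const, nsmul_eq_mul]
      _ ≤ ∑ v ∈ B.filter (fun v => ¬ P v), ((nbrsIn G v A).card : ℝ) :=
          Finset.sum_le_sum fun v hv => (not_le.1 (Finset.mem_filter.1 hv).2).le
      _ ≤ ∑ v ∈ B, ((nbrsIn G v A).card : ℝ) :=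
          Finset.sum_le_sum_of_subset_of_nonneg (Finset.filter_subset _ _)
            fun _ _ _ => Nat.cast_nonneg _
  have hpos : 0 < x * A.card := mul_pos hx (by exact_mod_cast hA.card_pos)
  have : 2 * ((B.filter (fun v => ¬ P v)).card : ℝ) ≤ B.card := by
    refine le_of_mul_le_mul_left ?_ hpos
    linarith
  linarith

/-- Deleting a vertex of at least average degree does not increase the edge density. -/
lemma exists_erase_edgesBetween_le {V : Type*} (G : SimpleGraph V) {x : ℝ} (hx : 0 ≤ x)
    {S : Finset V} (hS : S.Nonempty)
    (h : (edgesBetween G S S : ℝ) ≤ x * (S.card : ℝ) ^ 2) :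
    ∃ v ∈ S, (edgesBetween G (S.erase v) (S.erase v) : ℝ) ≤
      x * ((S.erase v).card : ℝ) ^ 2 := by
  obtain ⟨v, hv, hdeg⟩ : ∃ v ∈ S, edgesBetween G S S ≤ S.card * (nbrsIn G v S).card := by
    obtain ⟨v, hv, hmax⟩ := Finset.exists_max_image S (fun v => (nbrsIn G v S).card) hS
    refine ⟨v, hv, ?_⟩
    rw [edgesBetween_eq_sum_card, ← smul_eq_mul]
    exact Finset.sum_le_card_nsmul _ _ _ hmax
  refine ⟨v, hv, ?_⟩
  have hvv : edgesBetween G {v} {v} = 0 := by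
    simp [edgesBetween]
  have hdisj : Disjoint {v} (S.erase v) := by simp
  have hins : {v} ∪ S.erase v = S := by
    rw [← Finset.insert_eq, Finset.insert_erase hv]
  have hsplit := edgesBetween_union_self G hdisj
  have hdegv : (nbrsIn G v S).card = edgesBetween G {v} (S.erase v) := by
    have h1 : (nbrsIn G v S).card = edgesBetween G {v} S := by
      rw [edgesBetween_eq_sum_card, Finset.sum_singleton]
    rw [h1, edgesBetween_comm, ← hins, edgesBetween_union_left G hdisj, hvv, hins, zero_add,
      edgesBetween_comm]
  rw [hins, hvv, ← hdegv] at hsplit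
  have hcard : ((S.erase v).card : ℝ) = S.card - 1 := by
    rw [Finset.card_erase_of_mem hv, Nat.cast_sub hS.card_pos, Nat.cast_one]
  have hsplit' : (edgesBetween G S S : ℝ) =
      edgesBetween G (S.erase v) (S.erase v) + 2 * (nbrsIn G v S).card := by
    exact_mod_cast (by omega : edgesBetween G S S =
      edgesBetween G (S.erase v) (S.erase v) + 2 * (nbrsIn G v S).card)
  have hdeg' : (edgesBetween G S S : ℝ) ≤ S.card * (nbrsIn G v S).card := by
    exact_mod_cast hdeg
  rw [hcard]
  set s : ℝ := (S.card : ℝ)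
  set e : ℝ := (edgesBetween G S S : ℝ)
  have he : 0 ≤ e := Nat.cast_nonneg _
  have hs : 0 < s := Nat.cast_pos.2 hS.card_pos
  have key : s * edgesBetween G (S.erase v) (S.erase v) ≤ (s - 2) * e := by nlinarith
  refine le_of_mul_le_mul_left (key.trans ?_) hs
  rcases le_total s 2 with h2 | h2
  · exact (mul_nonpos_of_nonpos_of_nonneg (by linarith) he).trans (by positivity)
  · calc (s - 2) * e ≤ (s - 2) * (x * s ^ 2) := mul_le_mul_of_nonneg_left h (by linarith)
      _ ≤ s * (x * (s - 1) ^ 2) := by nlinarith [mul_nonneg hs.le hx]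

/-- A set contains subsets of every smaller size whose edge density is no larger. -/
lemma exists_subset_card_eq_edgesBetween_le {V : Type*} (G : SimpleGraph V) {x : ℝ}
    (hx : 0 ≤ x) {m : ℕ} {S : Finset V} (hm : m ≤ S.card)
    (h : (edgesBetween G S S : ℝ) ≤ x * (S.card : ℝ) ^ 2) :
    ∃ T ⊆ S, T.card = m ∧ (edgesBetween G T T : ℝ) ≤ x * (m : ℝ) ^ 2 := by
  induction S using Finset.strongInduction with
  | H S ih =>
    rcases hm.eq_or_lt with rfl | hlt
    · exact ⟨S, subset_rfl, rfl, h⟩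
    · obtain ⟨v, hv, hle⟩ :=
        exists_erase_edgesBetween_le G hx (Finset.card_pos.1 (by omega)) h
      obtain ⟨T, hT, hT'⟩ := ih _ (Finset.erase_ssubset hv)
        (by rw [Finset.card_erase_of_mem hv]; omega) hle
      exact ⟨T, hT.trans (Finset.erase_subset _ _), hT'⟩

/-- Either there is a transversal of the sets `B i` in which each pair `i ≠ j` is adjacent in the
prescribed graph `Γ i j`, or some pair contains large subsets that are sparse in that graph. -/
lemma exists_transversal_or_sparseTo {V W : Type*} [Nonempty V] (Γ : W → W → SimpleGraph V)
    (hΓ : ∀ i j, Γ i j = Γ j i) {c L : ℝ} (hc : 0 < c) (hc1 : c ≤ 1) (hL : 0 < L) {K : ℕ}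
    (T : Finset W) (hTK : T.card ≤ K) (B : W → Finset V)
    (hB : ∀ i ∈ T, K * L ≤ c ^ T.card * (B i).card) :
    (∃ f : W → V, (∀ i ∈ T, f i ∈ B i) ∧
      ∀ i ∈ T, ∀ j ∈ T, i ≠ j → (Γ i j).Adj (f i) (f j)) ∨
    ∃ i ∈ T, ∃ j ∈ T, i ≠ j ∧ ∃ A ⊆ B i, ∃ C ⊆ B j, L ≤ A.card ∧ L ≤ C.card ∧
      SparseTo (Γ i j) c C A := by
  induction T using Finset.induction_on generalizing B with
  | empty =>
    exact Or.inl ⟨fun _ => Classical.arbitrary V, by simp, by simp⟩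
  | insert i T hi ih =>
    rw [Finset.card_insert_of_notMem hi] at hB hTK
    have hbig : ∀ j ∈ insert i T, K * L ≤ (B j).card := fun j hj =>
      (hB j hj).trans (mul_le_of_le_one_left (Nat.cast_nonneg _) (pow_le_one₀ hc.le hc1))
    let D : W → Finset V := fun j =>
      (B i).filter fun v => ((nbrsIn (Γ i j) v (B j)).card : ℝ) ≤ c * (B j).card
    by_cases hD : ∃ j ∈ T, L ≤ (D j).card
    · obtain ⟨j, hj, hLj⟩ := hD
      refine Or.inr ⟨i, Finset.mem_insert_self _ _, j, Finset.mem_insert_of_mem hj,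
        fun h => hi (h ▸ hj), D j, Finset.filter_subset _ _, B j, subset_rfl, hLj, ?_,
        fun v hv => (Finset.mem_filter.1 hv).2⟩
      refine le_trans ?_ (hbig j (Finset.mem_insert_of_mem hj))
      exact le_mul_of_one_le_left hL.le (by exact_mod_cast (by omega : 1 ≤ K))
    · push Not at hD
      obtain ⟨v, hv, hvD⟩ : ∃ v ∈ B i, v ∉ T.biUnion D := by
        apply Finset.exists_mem_notMem_of_card_lt_card
        have h1 : ((T.biUnion D).card : ℝ) ≤ T.card * L := by
          calc ((T.biUnion D).card : ℝ) ≤ ∑ j ∈ T, ((D j).card : ℝ) := by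
                exact_mod_cast Finset.card_biUnion_le
            _ ≤ ∑ _j ∈ T, L := Finset.sum_le_sum fun j hj => (hD j hj).le
            _ = T.card * L := by rw [Finset.sum_const, nsmul_eq_mul]
        have h2 : (T.card : ℝ) * L < K * L :=
          mul_lt_mul_of_pos_right (by exact_mod_cast (by omega : T.card < K)) hL
        exact_mod_cast h1.trans_lt (h2.trans_le (hbig i (Finset.mem_insert_self _ _)))
      have hvc : ∀ j ∈ T, c * (B j).card ≤ (nbrsIn (Γ i j) v (B j)).card := by
        intro j hj
        by_contra hcon
        exact hvD (Finset.mem_biUnion.2 ⟨j, hj, Finset.mem_filter.2 ⟨hv, (not_le.1 hcon).le⟩⟩)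
      have hsub : ∀ j, nbrsIn (Γ i j) v (B j) ⊆ B j := fun j => Finset.filter_subset _ _
      rcases ih (by omega) (fun j => nbrsIn (Γ i j) v (B j)) (fun j hj => by
          calc K * L ≤ c ^ (T.card + 1) * (B j).card := hB j (Finset.mem_insert_of_mem hj)
            _ = c ^ T.card * (c * (B j).card) := by ring
            _ ≤ _ := mul_le_mul_of_nonneg_left (hvc j hj) (by positivity)) with
        ⟨f, hfB, hf⟩ | ⟨j, hj, k, hk, hjk, A, hA, C, hC, h⟩
      · have hadj : ∀ j ∈ T, (Γ i j).Adj v (f j) := fun j hj =>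
          (Finset.mem_filter.1 (hfB j hj)).2
        have hne : ∀ j ∈ T, j ≠ i := fun j hj h => hi (h ▸ hj)
        refine Or.inl ⟨Function.update f i v, fun j hj => ?_, fun j hj k hk hjk => ?_⟩
        · rcases Finset.mem_insert.1 hj with rfl | hj
          · simpa using hv
          · rw [Function.update_of_ne (hne j hj)]
            exact hsub j (hfB j hj)
        · rcases Finset.mem_insert.1 hj with rfl | hjT <;>
            rcases Finset.mem_insert.1 hk with rfl | hkT
          · exact absurd rfl hjk
          · rw [Function.update_self, Function.update_of_ne (hne k hkT)]
            exact hadj k hkT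
          · rw [Function.update_self, Function.update_of_ne (hne j hjT), hΓ]
            exact (hadj j hjT).symm
          · rw [Function.update_of_ne (hne k hkT), Function.update_of_ne (hne j hjT)]
            exact hf j hjT k hkT hjk
      · exact Or.inr ⟨j, Finset.mem_insert_of_mem hj, k, Finset.mem_insert_of_mem hk, hjk,
          A, hA.trans (hsub j), C, hC.trans (hsub k), h⟩

/-- A large set contains pairwise disjoint subsets of size `t`, one for each index. -/
lemma exists_disjoint_subsets {V W : Type*} [Fintype W] (X : Finset V) (t : ℕ)
    (h : Fintype.card W * t ≤ X.card) :
    ∃ B : W → Finset V, (∀ i, B i ⊆ X) ∧ (∀ i, (B i).card = t) ∧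
      ∀ i j, i ≠ j → Disjoint (B i) (B j) := by
  obtain ⟨e⟩ : Nonempty (W × Fin t ↪ X) :=
    Function.Embedding.nonempty_of_card_le (by simpa using h)
  refine ⟨fun i => Finset.univ.image fun s => (e (i, s) : V), fun i v hv => ?_, fun i => ?_,
    fun i j hij => Finset.disjoint_left.2 fun v hv hv' => ?_⟩
  · obtain ⟨s, -, rfl⟩ := Finset.mem_image.1 hv
    exact (e (i, s)).2
  · rw [Finset.card_image_of_injective, Finset.card_univ, Fintype.card_fin]
    intro s s' hs
    simpa using e.injective (Subtype.ext hs)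
  · obtain ⟨s, -, rfl⟩ := Finset.mem_image.1 hv
    obtain ⟨s', -, hs⟩ := Finset.mem_image.1 hv'
    exact hij (congrArg Prod.fst (e.injective (Subtype.ext hs))).symm

/-- An `H`-free graph has two linear-sized disjoint sets, one of them sparse to the other in the
graph or in its complement. -/
lemma Free.exists_sparseTo {V W : Type*} [Fintype W] [Nonempty W] {H : SimpleGraph W}
    {G : SimpleGraph V} (hG : Free H G) {c : ℝ} (hc : 0 < c) (hc1 : c ≤ 1) (X : Finset V)
    (hX : Fintype.card W ≤ X.card) :
    ∃ A ⊆ X, ∃ B ⊆ X, Disjoint A B ∧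
      c ^ Fintype.card W / (2 * (Fintype.card W : ℝ) ^ 2) * X.card ≤ A.card ∧
      c ^ Fintype.card W / (2 * (Fintype.card W : ℝ) ^ 2) * X.card ≤ B.card ∧
      (SparseTo G c B A ∨ SparseTo Gᶜ c B A) := by
  set K := Fintype.card W with hK
  have hK0 : 0 < K := Fintype.card_pos
  have hK0' : (0 : ℝ) < K := by exact_mod_cast hK0
  obtain ⟨B, hBX, hBcard, hBdisj⟩ := exists_disjoint_subsets (W := W) X (X.card / K)
    (Nat.mul_div_le _ _)
  have hX0 : (0 : ℝ) < X.card := by exact_mod_cast hK0.trans_le hX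
  have ht : (X.card : ℝ) ≤ 2 * K * (X.card / K : ℕ) := by
    have h1 : 1 ≤ X.card / K := (Nat.one_le_div_iff hK0).2 hX
    have h2 := Nat.lt_mul_div_succ X.card hK0
    have h3 : X.card ≤ 2 * K * (X.card / K) := by nlinarith
    exact_mod_cast h3
  obtain ⟨v, -⟩ := Finset.card_pos.1 (hK0.trans_le hX)
  have : Nonempty V := ⟨v⟩
  let Γ : W → W → SimpleGraph V := fun i j => if H.Adj i j then G else Gᶜ
  have hΓ : ∀ i j, Γ i j = Γ j i := fun i j => by simp only [Γ, H.adj_comm]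
  rcases exists_transversal_or_sparseTo Γ hΓ hc hc1
      (L := c ^ K / (2 * (K : ℝ) ^ 2) * X.card) (by positivity) (K := K) Finset.univ
      (by rw [Finset.card_univ]) B (fun i _ => by
        rw [Finset.card_univ, hBcard, ← hK]
        calc (K : ℝ) * (c ^ K / (2 * (K : ℝ) ^ 2) * X.card)
            = c ^ K * (X.card / (2 * K)) := by field_simp
          _ ≤ _ := by
            gcongr
            rw [div_le_iff₀ (by positivity)]
            linarith) with
    ⟨f, hfB, hf⟩ | ⟨i, -, j, -, hij, A, hA, C, hC, hLA, hLC, hs⟩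
  · refine absurd ⟨f, fun i j hij => ?_, fun i j => ?_⟩ hG
    · by_contra hne
      exact Finset.disjoint_left.1 (hBdisj i j hne) (hfB i (Finset.mem_univ _))
        (hij ▸ hfB j (Finset.mem_univ _))
    · by_cases hij : i = j
      · simp [hij]
      · have := hf i (Finset.mem_univ _) j (Finset.mem_univ _) hij
        by_cases hadj : H.Adj i j
        · simpa [Γ, hadj] using this
        · simp only [Γ, hadj, if_false, SimpleGraph.compl_adj] at this
          simp [hadj, this.2]
  · refine ⟨A, hA.trans (hBX i), C, hC.trans (hBX j),
      Finset.disjoint_of_subset_left hA (Finset.disjoint_of_subset_right hC (hBdisj i j hij)),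
      hLA, hLC, ?_⟩
    by_cases hadj : H.Adj i j
    · exact Or.inl (by simpa [Γ, hadj] using hs)
    · exact Or.inr (by simpa [Γ, hadj] using hs)

/-- Two sets sparse to each other allow the density of `Γ` to be lowered by a factor `3 / 4`. -/
lemma exists_subset_density_decrement {V : Type*} (Γ : SimpleGraph V) (R : Finset V → Prop)
    {x c ν : ℝ} (hc : 0 < c) (hcx : 4 * c ≤ x) {m : ℕ} {X A B : Finset V}
    (hA : A ⊆ X) (hB : B ⊆ X) (hAB : Disjoint A B) (hAν : ν ≤ A.card)
    (hBν : 2 * ν ≤ B.card) (hs : SparseTo Γ c B A)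
    (h : ∀ Y ⊆ X, ν ≤ Y.card → ∃ S ⊆ Y, S.card = m ∧
      ((edgesBetween Γ S S : ℝ) ≤ x * (m : ℝ) ^ 2 ∨ R S)) :
    ∃ S ⊆ X, S.card = m ∧ ((edgesBetween Γ S S : ℝ) ≤ 3 / 4 * x * (m : ℝ) ^ 2 ∨ R S) := by
  obtain ⟨A', hA', hA'm, hA's | hR⟩ := h A hA hAν
  swap
  · exact ⟨A', hA'.trans hA, hA'm, Or.inr hR⟩
  obtain ⟨C, hC, hCcard, hCs⟩ := exists_half_sparseTo Γ hc
    (A := A') (B := B) (by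
      have := (hs.mono le_rfl hA').weaklySparse
      unfold WeaklySparse
      linarith)
  obtain ⟨B', hB', hB'm, hB's | hR⟩ := h C (hC.trans hB) (by linarith)
  swap
  · exact ⟨B', hB'.trans (hC.trans hB), hB'm, Or.inr hR⟩
  have hdisj : Disjoint A' B' := Finset.disjoint_of_subset_left hA'
    (Finset.disjoint_of_subset_right (hB'.trans hC) hAB)
  have hcross : (edgesBetween Γ A' B' : ℝ) ≤ 2 * c * (m : ℝ) ^ 2 := by
    have := (hCs.mono le_rfl hB').weaklySparse
    rw [edgesBetween_comm, hA'm, hB'm] at this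
    linarith
  have hcard : (A' ∪ B').card = 2 * m := by
    rw [Finset.card_union_of_disjoint hdisj, hA'm, hB'm, two_mul]
  obtain ⟨S, hS, hSm, hSe⟩ := exists_subset_card_eq_edgesBetween_le Γ (x := 3 / 4 * x)
    (by linarith) (m := m) (S := A' ∪ B') (by omega) (by
      rw [edgesBetween_union_self Γ hdisj, hcard]
      push_cast
      nlinarith [sq_nonneg (m : ℝ)])
  exact ⟨S, hS.trans (Finset.union_subset (hA'.trans hA) (hB'.trans (hC.trans hB))), hSm,
    Or.inl hSe⟩

lemma exists_subset_edgesBetween_le_sq {V : Type*} (Γ : SimpleGraph V) {X : Finset V} {m : ℕ}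
    (h : (m : ℝ) ≤ 1 * X.card) :
    ∃ S ⊆ X, S.card = m ∧ (edgesBetween Γ S S : ℝ) ≤ (3 / 4) ^ 0 * (m : ℝ) ^ 2 := by
  obtain ⟨S, hS, hSm⟩ := Finset.exists_subset_card_eq (s := X) (n := m)
    (by exact_mod_cast (one_mul (X.card : ℝ)) ▸ h)
  refine ⟨S, hS, hSm, ?_⟩
  rw [pow_zero, one_mul, sq]
  exact_mod_cast hSm ▸ edgesBetween_le_mul Γ S S

/-- The density form of Rödl's theorem, with sets of every prescribed size up to `δ * |X|`. -/
lemma Free.exists_subset_density_le {W : Type*} [Fintype W] [Nonempty W] (H : SimpleGraph W)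
    (p q : ℕ) :
    ∃ δ : ℝ, 0 < δ ∧ ∀ (V : Type) (G : SimpleGraph V), Free H G →
      ∀ (X : Finset V) (m : ℕ), (m : ℝ) ≤ δ * X.card → ∃ S ⊆ X, S.card = m ∧
        ((edgesBetween G S S : ℝ) ≤ (3 / 4) ^ p * (m : ℝ) ^ 2 ∨
          (edgesBetween Gᶜ S S : ℝ) ≤ (3 / 4) ^ q * (m : ℝ) ^ 2) := by
  induction p generalizing q with
  | zero =>
    refine ⟨1, one_pos, fun V G _ X m hm => ?_⟩
    obtain ⟨S, hS, hSm, h⟩ := exists_subset_edgesBetween_le_sq G hm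
    exact ⟨S, hS, hSm, Or.inl h⟩
  | succ p ihp =>
    induction q with
    | zero =>
      refine ⟨1, one_pos, fun V G _ X m hm => ?_⟩
      obtain ⟨S, hS, hSm, h⟩ := exists_subset_edgesBetween_le_sq Gᶜ hm
      exact ⟨S, hS, hSm, Or.inr h⟩
    | succ q ihq =>
      obtain ⟨δ₁, hδ₁, h₁⟩ := ihp (q + 1)
      obtain ⟨δ₂, hδ₂, h₂⟩ := ihq
      let c : ℝ := (3 / 4) ^ (p + q) / 4
      let K : ℝ := Fintype.card W
      let γ : ℝ := c ^ Fintype.card W / (2 * K ^ 2)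
      have hc : 0 < c := by positivity
      have hcp : 4 * c ≤ (3 / 4) ^ p := by
        have : ((3 : ℝ) / 4) ^ (p + q) ≤ (3 / 4) ^ p :=
          pow_le_pow_of_le_one (by norm_num) (by norm_num) (by omega)
        simp only [c]; linarith
      have hcq : 4 * c ≤ (3 / 4) ^ q := by
        have : ((3 : ℝ) / 4) ^ (p + q) ≤ (3 / 4) ^ q :=
          pow_le_pow_of_le_one (by norm_num) (by norm_num) (by omega)
        simp only [c]; linarith
      have hc1 : c ≤ 1 := by
        have : ((3 : ℝ) / 4) ^ p ≤ 1 := pow_le_one₀ (by norm_num) (by norm_num)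
        linarith
      have hK : 0 < K := Nat.cast_pos.2 Fintype.card_pos
      have hγ : 0 < γ := by positivity
      refine ⟨min (min δ₁ δ₂ * (γ / 2)) (1 / K), by positivity, fun V G hG X m hm => ?_⟩
      rcases Nat.eq_zero_or_pos m with rfl | hm0
      · exact ⟨∅, by simp, by simp, by simp [edgesBetween]⟩
      have hX : Fintype.card W ≤ X.card := by
        have h1 : (1 : ℝ) ≤ 1 / K * X.card :=
          (show (1 : ℝ) ≤ m by exact_mod_cast hm0).trans
            (hm.trans (mul_le_mul_of_nonneg_right (min_le_right _ _) (Nat.cast_nonneg _)))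
        rw [one_div, inv_mul_eq_div, le_div_iff₀ hK, one_mul] at h1
        exact Nat.cast_le.1 h1
      have hmδ : (m : ℝ) ≤ min δ₁ δ₂ * (γ / 2 * X.card) := by
        rw [← mul_assoc]
        exact hm.trans (mul_le_mul_of_nonneg_right (min_le_left _ _) (Nat.cast_nonneg _))
      have hmY : ∀ Y : Finset V, γ / 2 * X.card ≤ Y.card →
          (m : ℝ) ≤ δ₁ * Y.card ∧ (m : ℝ) ≤ δ₂ * Y.card := fun Y hY =>
        ⟨hmδ.trans (mul_le_mul (min_le_left _ _) hY (by positivity) hδ₁.le),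
          hmδ.trans (mul_le_mul (min_le_right _ _) hY (by positivity) hδ₂.le)⟩
      obtain ⟨A, hA, B, hB, hAB, hAc, hBc, hs⟩ := hG.exists_sparseTo hc hc1 X hX
      change γ * X.card ≤ A.card at hAc
      change γ * X.card ≤ B.card at hBc
      have hγX : 0 ≤ γ * X.card := by positivity
      rcases hs with hs | hs
      · rw [pow_succ' _ p]
        exact exists_subset_density_decrement G
          (fun S => (edgesBetween Gᶜ S S : ℝ) ≤ (3 / 4) ^ (q + 1) * (m : ℝ) ^ 2) hc hcp hA hB hAB
          (ν := γ / 2 * X.card) (by linarith) (by linarith) hs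
          fun Y _ hY => h₁ V G hG Y m (hmY Y hY).1
      · obtain ⟨S, hS, hSm, h⟩ := exists_subset_density_decrement Gᶜ
          (fun S => (edgesBetween G S S : ℝ) ≤ (3 / 4) ^ (p + 1) * (m : ℝ) ^ 2) hc hcq hA hB hAB
          (ν := γ / 2 * X.card) (by linarith) (by linarith) hs fun Y _ hY =>
            (h₂ V G hG Y m (hmY Y hY).2).imp fun S hS => ⟨hS.1, hS.2.1, hS.2.2.symm⟩
        rw [← pow_succ'] at h
        exact ⟨S, hS, hSm, h.symm⟩

/-- A set with few edges contains a subset of half the size with small maximum degree. -/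
lemma exists_half_sparseOn {V : Type*} (G : SimpleGraph V) {ε : ℝ} (hε : 0 < ε) {S : Finset V}
    (h : (edgesBetween G S S : ℝ) ≤ ε / 4 * (S.card : ℝ) ^ 2) :
    ∃ T : Finset V, (S.card : ℝ) ≤ 2 * T.card ∧ SparseOn G T ε := by
  obtain ⟨T, hT, hcard, hs⟩ := exists_half_sparseTo G (x := ε / 4) (by positivity)
    (A := S) (B := S) (by unfold WeaklySparse; linarith)
  refine ⟨T, hcard, fun v hv => ?_⟩
  calc ((nbrsIn G v T).card : ℝ) ≤ (nbrsIn G v S).card := by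
        exact_mod_cast Finset.card_le_card (nbrsIn_mono G v hT)
    _ ≤ 2 * (ε / 4) * S.card := hs v hv
    _ ≤ ε * T.card := by nlinarith

/-- Rödl's theorem. -/
theorem rodl_theorem
    (ε : ℝ) (hε : 0 < ε) (hε2 : ε < 1/2)
    (W : Type) [Fintype W] (H : SimpleGraph W) :
    ∃ δ : ℝ, 0 < δ ∧
      ∀ (V : Type) [Fintype V] (G : SimpleGraph V), Free H G →
        ∃ S : Finset V, δ * (Fintype.card V : ℝ) ≤ (S.card : ℝ) ∧
          RestrictedOn G S ε := by
  rcases isEmpty_or_nonempty W with hW | hW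
  · exact ⟨1, one_pos, fun V _ G hG => absurd
      ⟨fun i => (hW.false i).elim, fun i => (hW.false i).elim, fun i => (hW.false i).elim⟩ hG⟩
  obtain ⟨p, hp⟩ := exists_pow_lt_of_lt_one (show 0 < ε / 4 by positivity)
    (show (3 / 4 : ℝ) < 1 by norm_num)
  obtain ⟨δ, hδ, h⟩ := Free.exists_subset_density_le H p p
  refine ⟨δ / 4, by positivity, fun V _ G hG => ?_⟩
  rcases lt_or_ge (δ * Fintype.card V) 1 with hn | hn
  · rcases isEmpty_or_nonempty V with hV | ⟨⟨v⟩⟩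
    · exact ⟨∅, by simp, Or.inl (by simp [SparseOn])⟩
    · refine ⟨{v}, by rw [Finset.card_singleton]; push_cast; linarith, Or.inl fun u hu => ?_⟩
      rw [Finset.mem_singleton.1 hu]
      simpa [nbrsIn, Finset.filter_singleton] using hε.le
  obtain ⟨S, -, hSm, hS⟩ := h V G hG Finset.univ ⌊δ * Fintype.card V⌋₊
    (by rw [Finset.card_univ]; exact Nat.floor_le (by linarith))
  have hfloor : δ * Fintype.card V ≤ 2 * S.card := by
    have h1 : (1 : ℝ) ≤ S.card := by
      rw [hSm]; exact Nat.one_le_cast.2 (Nat.le_floor (by simpa using hn))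
    have h2 := Nat.lt_floor_add_one (δ * Fintype.card V)
    rw [← hSm] at h2
    linarith
  rw [← hSm] at hS
  have hweak : ∀ Γ : SimpleGraph V,
      (edgesBetween Γ S S : ℝ) ≤ (3 / 4) ^ p * (S.card : ℝ) ^ 2 →
      ∃ T : Finset V, (S.card : ℝ) ≤ 2 * T.card ∧ SparseOn Γ T ε := fun Γ hΓ =>
    exists_half_sparseOn Γ hε
      (hΓ.trans (mul_le_mul_of_nonneg_right hp.le (sq_nonneg _)))
  rcases hS with hS | hS
  · obtain ⟨T, hT, hTs⟩ := hweak G hS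
    exact ⟨T, by linarith, Or.inl hTs⟩
  · obtain ⟨T, hT, hTs⟩ := hweak Gᶜ hS
    exact ⟨T, by linarith, Or.inr hTs⟩
end
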